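/- Let A be an abelian category in which every short exact sequence splits. Then for every distinguished triangle X → Y → Z → X[1] in the bounded homotopy category K^b(A), the object Y is a direct summand of X ⊕ Z; that is, there exist morphisms i : Y → X ⊕ Z and p : X ⊕ Z → Y in K^b(A) with p ∘ i = id_Y. -/

import Mathlib

open CategoryTheory CategoryTheory.Limits CategoryTheory.Pretriangulated

theorem aux_regular {A : Type*} [Category A] [Abelian A]
    (hsplit : ∀ (S : ShortComplex A), S.ShortExact → Nonempty S.Splitting)
    {X Y : A} (f : X ⟶ Y) : ∃ g : Y ⟶ X, f ≫ g ≫ f = f := by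
  obtain ⟨s1⟩ := hsplit (ShortComplex.mk (kernel.ι (factorThruImage f)) (factorThruImage f)
    (kernel.condition _))
    { exact := ShortComplex.exact_of_f_is_kernel _ (kernelIsKernel _)
      mono_f := by dsimp; infer_instance
      epi_g := by dsimp; infer_instance }
  obtain ⟨s2⟩ := hsplit (ShortComplex.mk (image.ι f) (cokernel.π (image.ι f))
    (cokernel.condition _))
    { exact := ShortComplex.exact_of_g_is_cokernel _ (cokernelIsCokernel _)
      mono_f := by dsimp; infer_instance
      epi_g := by dsimp; infer_instance }
  have e1 : s1.s ≫ factorThruImage f = 𝟙 _ := s1.s_g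
  have e2 : image.ι f ≫ s2.r = 𝟙 _ := s2.f_r
  refine ⟨s2.r ≫ s1.s, ?_⟩
  calc f ≫ (s2.r ≫ s1.s) ≫ f
      = (factorThruImage f ≫ image.ι f) ≫ (s2.r ≫ s1.s) ≫ (factorThruImage f ≫ image.ι f) := by
        rw [image.fac]
    _ = factorThruImage f ≫ (image.ι f ≫ s2.r) ≫ (s1.s ≫ factorThruImage f) ≫ image.ι f := by
        simp only [Category.assoc]
    _ = f := by rw [e1, e2]; simp

theorem aux_e {A : Type*} [Category A] [Abelian A]
    (hsplit : ∀ (S : ShortComplex A), S.ShortExact → Nonempty S.Splitting)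
    (X : CochainComplex A ℤ) : ∃ e : X ⟶ X,
      (HomotopyCategory.quotient A (ComplexShape.up ℤ)).map e = 𝟙 _ ∧
      (∀ i j, e.f i ≫ X.d i j = 0) ∧ (∀ i j, X.d i j ≫ e.f j = 0) := by
  choose s hs using fun i j : ℤ => aux_regular hsplit (X.d i j)
  let N := Homotopy.nullHomotopicMap' (C := X) (D := X) (c := ComplexShape.up ℤ)
    (fun i j _ => s j i)
  have hN : ∀ i j k : ℤ, i + 1 = j → j + 1 = k →
      N.f j = X.d j k ≫ s j k + s i j ≫ X.d i j := fun i j k h1 h2 =>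
    Homotopy.nullHomotopicMap'_f (c := ComplexShape.up ℤ) (k₂ := i) (k₁ := j) (k₀ := k) h1 h2 _
  refine ⟨𝟙 X - N, ?_, ?_, ?_⟩
  · have h0 : (HomotopyCategory.quotient A (ComplexShape.up ℤ)).map N = 0 :=
      (HomotopyCategory.quotient_map_eq_zero_iff N).2 ⟨Homotopy.nullHomotopy' _⟩
    rw [Functor.map_sub, h0, sub_zero, CategoryTheory.Functor.map_id]
  · intro i j
    by_cases h : i + 1 = j
    · have := hN (i-1) i j (by omega) h
      simp [this, hs]
    · rw [X.shape _ _ h, comp_zero]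
  · intro i j
    by_cases h : i + 1 = j
    · have := hN i j (j+1) h rfl
      simp [this, hs]
    · rw [X.shape _ _ h, zero_comp]

theorem aux_reg2 {A : Type*} [Category A] [Abelian A]
    (hsplit : ∀ (S : ShortComplex A), S.ShortExact → Nonempty S.Splitting)
    {X Y : HomotopyCategory A (ComplexShape.up ℤ)} (f : X ⟶ Y) :
    ∃ g : Y ⟶ X, f ≫ g ≫ f = f := by
  obtain ⟨X⟩ := X
  obtain ⟨Y⟩ := Y
  let Q := HomotopyCategory.quotient A (ComplexShape.up ℤ)
  obtain ⟨f, rfl⟩ := Q.map_surjective (X := X) (Y := Y) f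
  obtain ⟨eX, hX, hX1, hX2⟩ := aux_e hsplit X
  obtain ⟨eY, hY, hY1, hY2⟩ := aux_e hsplit Y
  choose ψ hψ using fun i : ℤ => aux_regular hsplit ((eX ≫ f ≫ eY).f i)
  let g : Y ⟶ X :=
    { f := fun i => eY.f i ≫ ψ i ≫ eX.f i
      comm' := fun i j _ => by
        simp only [Category.assoc, hX1, comp_zero]
        rw [← Category.assoc, hY2, zero_comp] }
  have key : eX ≫ (f ≫ g ≫ f) ≫ eY = eX ≫ f ≫ eY := by
    ext i
    have := hψ i
    simpa [g] using this
  refine ⟨Q.map g, ?_⟩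
  have := congrArg Q.map key
  simp only [Functor.map_comp] at this
  change Q.map eX = 𝟙 _ at hX
  change Q.map eY = 𝟙 _ at hY
  rw [hX, hY] at this
  simp only [Category.id_comp, Category.comp_id] at this
  exact this

open CategoryTheory CategoryTheory.Limits CategoryTheory.Pretriangulated

/-- Over an abelian category `A` in which every short exact sequence splits, for every
distinguished triangle `X ⟶ Y ⟶ Z ⟶ X[1]` in the bounded homotopy category (formalized as
a distinguished triangle in the homotopy category of cochain complexes whose three objects
are represented by bounded complexes), the middle object `Y` is a direct summand of
`X ⊞ Z`: there are morphisms `i : Y ⟶ X ⊞ Z` and `p : X ⊞ Z ⟶ Y` with `i ≫ p = 𝟙 Y`. -/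
theorem middle_is_direct_summand_of_semisimple
    {A : Type*} [Category A] [Abelian A]
    (hsplit : ∀ (S : ShortComplex A), S.ShortExact → Nonempty S.Splitting)
    (T : Triangle (HomotopyCategory A (ComplexShape.up ℤ)))
    (hT : T ∈ distTriang (HomotopyCategory A (ComplexShape.up ℤ)))
    (a b : ℤ)
    (h₁ : ∀ n : ℤ, n < a ∨ b < n → IsZero ((T.obj₁).as.X n))
    (h₂ : ∀ n : ℤ, n < a ∨ b < n → IsZero ((T.obj₂).as.X n))
    (h₃ : ∀ n : ℤ, n < a ∨ b < n → IsZero ((T.obj₃).as.X n)) :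
    ∃ (i : T.obj₂ ⟶ T.obj₁ ⊞ T.obj₃) (p : T.obj₁ ⊞ T.obj₃ ⟶ T.obj₂),
      i ≫ p = 𝟙 T.obj₂ := by
  obtain ⟨g, hg⟩ := aux_reg2 hsplit T.mor₁
  obtain ⟨u, hu⟩ := Triangle.yoneda_exact₂ T hT (𝟙 _ - g ≫ T.mor₁) (by simp [hg])
  refine ⟨biprod.lift g T.mor₂, biprod.desc T.mor₁ u, ?_⟩
  rw [biprod.lift_desc, ← hu]
  abel
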